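/- Let (t₀,x₀) ∈ (0,T)×ℝ satisfy e^{r(T−t₀)}x₀ + g₁(t₀) = 0. Then the parabolic subjet of V at (t₀,x₀) is exactly the set {(0,0,P₀) : P₀ ∈ ℝ, P₀ ≤ e^{(2A₁+2r)(T−t₀)}}. -/

import Mathlib

open Real Set Asymptotics

open Filter Topology

/-- A linear function bounded above by a function that is `o(s - c)` has zero slope. -/
lemma slope_eq_zero_of_le_isLittleO {q c : ℝ} {e : ℝ → ℝ}
    (he : e =o[𝓝 c] fun s => s - c) (h : ∀ s, q * (s - c) ≤ e s) : q = 0 := by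
  by_contra hq
  have hq' : 0 < |q| := abs_pos.mpr hq
  have hb := he.def (half_pos hq')
  obtain ⟨δ, hδ, hball⟩ := Metric.eventually_nhds_iff.mp hb
  have key : ∀ u : ℝ, |u| < δ → q * u ≤ |q| / 2 * |u| := by
    intro u hu
    have h1 := hball (y := c + u) (by simpa [Real.dist_eq] using hu)
    have h2 := h (c + u)
    simp only [Real.norm_eq_abs, add_sub_cancel_left] at h1 h2
    exact h2.trans ((le_abs_self _).trans h1)
  have hd : |δ / 2| = δ / 2 := abs_of_pos (half_pos hδ)
  have k1 := key (δ / 2) (by rw [hd]; linarith)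
  have k2 := key (-(δ / 2)) (by rw [abs_neg, hd]; linarith)
  rw [abs_neg] at k2
  rw [hd] at k1 k2
  rcases abs_cases q with ⟨h1, _⟩ | ⟨h1, _⟩ <;> rw [h1] at k1 k2 hq' <;> nlinarith

/-- The square of a function that is differentiable and vanishes at `c` is `o(s - c)`. -/
lemma isLittleO_sq_of_differentiableAt {z : ℝ → ℝ} {c : ℝ} (hz : DifferentiableAt ℝ z c)
    (h0 : z c = 0) : (fun s => z s ^ 2) =o[𝓝 c] fun s => s - c := by
  have h1 : z =O[𝓝 c] fun s => s - c := by simpa [h0] using hz.isBigO_sub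
  have h2 : z =o[𝓝 c] fun _ => (1 : ℝ) := by
    rw [isLittleO_one_iff]
    simpa [h0] using hz.continuousAt.tendsto
  simpa [sq] using h1.mul_isLittleO h2

/-- If `(P - M) (y - c)² ≤ e y` for `y < c`, with `e = o((y - c)²)`, then `P ≤ M`. -/
lemma coeff_le_of_le_isLittleO {P M c : ℝ} {e : ℝ → ℝ}
    (he : e =o[𝓝 c] fun y => (y - c) ^ 2)
    (h : ∀ y < c, (P - M) * (y - c) ^ 2 ≤ e y) : P ≤ M := by
  by_contra! hlt
  have hb := he.def (half_pos (sub_pos.mpr hlt))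
  obtain ⟨δ, hδ, hball⟩ := Metric.eventually_nhds_iff.mp hb
  have h1 := hball (y := c - δ / 2) (by
    rw [Real.dist_eq, abs_lt]; constructor <;> linarith)
  have h2 := h (c - δ / 2) (by linarith)
  simp only [Real.norm_eq_abs, abs_sq] at h1
  have h3 := h2.trans ((le_abs_self _).trans h1)
  have h4 : 0 < (c - δ / 2 - c) ^ 2 := by
    have : c - δ / 2 - c ≠ 0 := by linarith
    positivity
  nlinarith [mul_pos (sub_pos.mpr hlt) h4]

/-- The defect `k² (y - x₀)² - (K s (y - x₀) + G s)²`, without its nonpositive term `-G²`, is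
`o(|s - t₀| + |y - x₀|²)` when `K → k` is continuous and `G` is differentiable and vanishes
at `t₀`. -/
lemma isLittleO_quadratic_defect {K G : ℝ → ℝ} {t₀ x₀ : ℝ} (hK : ContinuousAt K t₀)
    (hG : DifferentiableAt ℝ G t₀) (hG0 : G t₀ = 0) :
    (fun p : ℝ × ℝ => (K t₀ ^ 2 - K p.1 ^ 2) * (p.2 - x₀) ^ 2
        - 2 * K p.1 * (p.2 - x₀) * G p.1)
      =o[𝓝 (t₀, x₀)] fun p : ℝ × ℝ => |p.1 - t₀| + |p.2 - x₀| ^ 2 := by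
  have hfst : Tendsto (Prod.fst : ℝ × ℝ → ℝ) (𝓝 (t₀, x₀)) (𝓝 t₀) := continuous_fst.tendsto _
  have hsnd : Tendsto (Prod.snd : ℝ × ℝ → ℝ) (𝓝 (t₀, x₀)) (𝓝 x₀) := continuous_snd.tendsto _
  have hKp : Tendsto (fun p : ℝ × ℝ => K p.1) (𝓝 (t₀, x₀)) (𝓝 (K t₀)) := hK.tendsto.comp hfst
  have hx : (fun p : ℝ × ℝ => (p.2 - x₀) ^ 2)
      =O[𝓝 (t₀, x₀)] fun p : ℝ × ℝ => |p.1 - t₀| + |p.2 - x₀| ^ 2 := by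
    refine IsBigO.of_bound 1 (Eventually.of_forall fun p => ?_)
    rw [Real.norm_of_nonneg (by positivity), Real.norm_of_nonneg (by positivity), sq_abs]
    linarith [abs_nonneg (p.1 - t₀)]
  have ht : (fun p : ℝ × ℝ => p.1 - t₀)
      =O[𝓝 (t₀, x₀)] fun p : ℝ × ℝ => |p.1 - t₀| + |p.2 - x₀| ^ 2 := by
    refine IsBigO.of_bound 1 (Eventually.of_forall fun p => ?_)
    rw [Real.norm_of_nonneg (by positivity : 0 ≤ |p.1 - t₀| + |p.2 - x₀| ^ 2), Real.norm_eq_abs]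
    linarith [sq_nonneg |p.2 - x₀|]
  have hGO : (fun p : ℝ × ℝ => G p.1) =O[𝓝 (t₀, x₀)] fun p : ℝ × ℝ => p.1 - t₀ := by
    have h1 : G =O[𝓝 t₀] fun s => s - t₀ := by simpa [hG0] using hG.isBigO_sub
    exact h1.comp_tendsto hfst
  have h1 : (fun p : ℝ × ℝ => K t₀ ^ 2 - K p.1 ^ 2) =o[𝓝 (t₀, x₀)] fun _ => (1 : ℝ) := by
    rw [isLittleO_one_iff]
    exact sub_self (K t₀ ^ 2) ▸ (hKp.pow 2).const_sub (K t₀ ^ 2)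
  have h2 : (fun p : ℝ × ℝ => 2 * K p.1 * (p.2 - x₀)) =o[𝓝 (t₀, x₀)] fun _ => (1 : ℝ) := by
    rw [isLittleO_one_iff]
    simpa using (hKp.const_mul 2).mul (hsnd.sub_const x₀)
  have h3 := h1.mul_isBigO hx
  have h4 := h2.mul_isBigO (hGO.trans ht)
  simp only [one_mul] at h3 h4
  exact h3.sub h4

/-- on the switching curve, the parabolic subjet of V at (t₀,x₀)
is exactly {(0,0,P₀) : P₀ ≤ e^{(2A₁+2r)(T−t₀)}}.  A triple (q₀,p₀,P₀) belongs to
the subjet iff the positive part of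
V(t₀,x₀) + q₀(s−t₀) + p₀(y−x₀) + ½P₀(y−x₀)² − V(s,y)
is o(|s−t₀| + |y−x₀|²) as (s,y) → (t₀,x₀) in [0,T]×ℝ. -/
theorem stmt_10
    (T r μ σ a b η θ d γ : ℝ)
    (hT : 0 < T) (hr : 0 < r) (hσ : 0 < σ) (ha : 0 < a) (hb : 0 < b)
    (hη : 0 < η) (hμr : r < μ)
    (f : ℝ) (hf : f = a * θ - a * η + (d - γ) * r)
    (A₁ : ℝ) (hA₁ : A₁ = -(μ - r) ^ 2 / (2 * σ ^ 2) - a ^ 2 * η ^ 2 / (2 * b ^ 2))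
    (g₁ : ℝ → ℝ) (hg₁ : ∀ t, g₁ t = f * (exp (r * (T - t)) - 1) / r)
    (V : ℝ → ℝ → ℝ)
    (hV : ∀ t x, V t x =
      if 0 ≤ exp (r * (T - t)) * x + g₁ t
      then (1 / 2) * (exp (r * (T - t)) * x + g₁ t) ^ 2
      else (1 / 2) * exp (2 * A₁ * (T - t)) * (exp (r * (T - t)) * x + g₁ t) ^ 2)
    (t₀ x₀ : ℝ) (ht₀ : t₀ ∈ Ioo (0 : ℝ) T)
    (hsw : exp (r * (T - t₀)) * x₀ + g₁ t₀ = 0) :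
    {w : ℝ × ℝ × ℝ |
      (fun p : ℝ × ℝ =>
          max (V t₀ x₀ + w.1 * (p.1 - t₀) + w.2.1 * (p.2 - x₀)
            + (1 / 2) * w.2.2 * (p.2 - x₀) ^ 2 - V p.1 p.2) 0)
        =o[nhdsWithin (t₀, x₀) (Icc (0 : ℝ) T ×ˢ (univ : Set ℝ))]
      (fun p : ℝ × ℝ => |p.1 - t₀| + |p.2 - x₀| ^ 2)}
    = {w : ℝ × ℝ × ℝ | w.1 = 0 ∧ w.2.1 = 0 ∧ w.2.2 ≤ exp ((2 * A₁ + 2 * r) * (T - t₀))} := by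
  have hA : A₁ ≤ 0 := by
    rw [hA₁, neg_div]
    have h1 : 0 ≤ (μ - r) ^ 2 / (2 * σ ^ 2) := by positivity
    have h2 : 0 ≤ a ^ 2 * η ^ 2 / (2 * b ^ 2) := by positivity
    linarith
  have hV0 : V t₀ x₀ = 0 := by rw [hV, hsw]; simp
  have hVle : ∀ t ≤ T, ∀ x, V t x ≤ (1 / 2) * (exp (r * (T - t)) * x + g₁ t) ^ 2 := by
    intro t ht x
    rw [hV]
    split_ifs
    · exact le_rfl
    · have h1 : exp (2 * A₁ * (T - t)) ≤ 1 := by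
        rw [exp_le_one_iff]
        exact mul_nonpos_of_nonpos_of_nonneg (by linarith) (by linarith)
      nlinarith [sq_nonneg (exp (r * (T - t)) * x + g₁ t)]
  have hVge : ∀ t ≤ T, ∀ x, (1 / 2) * exp (2 * A₁ * (T - t)) *
      (exp (r * (T - t)) * x + g₁ t) ^ 2 ≤ V t x := by
    intro t ht x
    rw [hV]
    split_ifs
    · have h1 : exp (2 * A₁ * (T - t)) ≤ 1 := by
        rw [exp_le_one_iff]
        exact mul_nonpos_of_nonpos_of_nonneg (by linarith) (by linarith)
      nlinarith [sq_nonneg (exp (r * (T - t)) * x + g₁ t)]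
    · exact le_rfl
  have hg₁' : g₁ = fun t => f * (exp (r * (T - t)) - 1) / r := funext hg₁
  have hzd : DifferentiableAt ℝ (fun t => exp (r * (T - t)) * x₀ + g₁ t) t₀ := by
    rw [hg₁']; fun_prop
  have hz₀ : ∀ y, exp (r * (T - t₀)) * y + g₁ t₀ = exp (r * (T - t₀)) * (y - x₀) := by
    intro y; linear_combination hsw
  have hmem : Icc (0 : ℝ) T ×ˢ (univ : Set ℝ) ∈ 𝓝 (t₀, x₀) :=
    prod_mem_nhds (Icc_mem_nhds ht₀.1 ht₀.2) univ_mem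
  rw [nhdsWithin_eq_nhds.mpr hmem]
  ext ⟨q, p, P⟩
  simp only [mem_ofPred_eq, hV0, zero_add]
  constructor
  · intro h
    have hyt : Tendsto (fun y : ℝ => (t₀, y)) (𝓝 x₀) (𝓝 (t₀, x₀)) :=
      (Continuous.prodMk_right t₀).tendsto x₀
    have hst : Tendsto (fun s : ℝ => (s, x₀)) (𝓝 t₀) (𝓝 (t₀, x₀)) :=
      (Continuous.prodMk_left x₀).tendsto t₀
    have hy := h.comp_tendsto hyt
    have hs := h.comp_tendsto hst
    simp only [Function.comp_def, sub_self, mul_zero, abs_zero, zero_add, sq_abs] at hy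
    simp only [Function.comp_def, sub_self, mul_zero, abs_zero, add_zero, ne_eq,
      OfNat.ofNat_ne_zero, not_false_eq_true, zero_pow, isLittleO_abs_right] at hs
    have hsq : (fun y : ℝ => (y - x₀) ^ 2) =o[𝓝 x₀] fun y => y - x₀ :=
      isLittleO_sq_of_differentiableAt (z := fun y => y - x₀) (by fun_prop) (sub_self x₀)
    have hp : p = 0 := by
      refine slope_eq_zero_of_le_isLittleO ((hy.trans hsq).add
        (hsq.const_mul_left ((1 / 2) * exp (r * (T - t₀)) ^ 2 - (1 / 2) * P))) fun y => ?_
      have h1 := hVle t₀ ht₀.2.le y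
      rw [hz₀] at h1
      have h2 := le_max_left (p * (y - x₀) + 1 / 2 * P * (y - x₀) ^ 2 - V t₀ y) 0
      linarith
    have hq : q = 0 := by
      have hpos : (fun s => V s x₀) =o[𝓝 t₀] fun s => s - t₀ := by
        refine IsBigO.trans_isLittleO (IsBigO.of_bound 1 ?_)
          (isLittleO_sq_of_differentiableAt hzd hsw)
        filter_upwards [Iic_mem_nhds ht₀.2] with s hs
        have h1 := hVle s hs x₀
        have h2 := hVge s hs x₀
        have h3 : 0 ≤ V s x₀ := le_trans (by positivity) h2
        rw [Real.norm_of_nonneg h3, Real.norm_of_nonneg (by positivity)]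
        nlinarith [sq_nonneg (exp (r * (T - s)) * x₀ + g₁ s)]
      refine slope_eq_zero_of_le_isLittleO (hs.add hpos) fun s => ?_
      have h2 := le_max_left (q * (s - t₀) - V s x₀) 0
      linarith
    refine ⟨hq, hp, coeff_le_of_le_isLittleO (hy.const_mul_left 2) fun y hlt => ?_⟩
    have hneg : ¬ 0 ≤ exp (r * (T - t₀)) * (y - x₀) :=
      not_le.mpr (mul_neg_of_pos_of_neg (exp_pos _) (sub_neg.mpr hlt))
    have hVy : V t₀ y = (1 / 2) * exp ((2 * A₁ + 2 * r) * (T - t₀)) * (y - x₀) ^ 2 := by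
      rw [hV, hz₀, if_neg hneg, mul_pow, ← exp_nat_mul]
      rw [show (2 * A₁ + 2 * r) * (T - t₀) = 2 * A₁ * (T - t₀) + (2 : ℕ) * (r * (T - t₀)) by
        push_cast; ring, exp_add]
      ring
    have h2 := le_max_left (p * (y - x₀) + 1 / 2 * P * (y - x₀) ^ 2 - V t₀ y) 0
    rw [hp, hVy] at h2
    rw [hp, hVy]
    linarith
  · rintro ⟨rfl, rfl, hP⟩
    refine IsBigO.trans_isLittleO (IsBigO.of_bound 1 ?_)
      (isLittleO_quadratic_defect (K := fun s => exp ((A₁ + r) * (T - s)))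
        (G := fun s => exp (A₁ * (T - s)) * (exp (r * (T - s)) * x₀ + g₁ s))
        (by fun_prop) (DifferentiableAt.mul (by fun_prop) hzd) (by rw [hsw, mul_zero]))
    filter_upwards [hmem] with w hw
    have hVw := hVge w.1 hw.1.2 w.2
    have e1 : exp ((A₁ + r) * (T - w.1)) = exp (A₁ * (T - w.1)) * exp (r * (T - w.1)) := by
      rw [← exp_add]; ring_nf
    have e2 : exp (2 * A₁ * (T - w.1)) = exp (A₁ * (T - w.1)) ^ 2 := by
      rw [← exp_nat_mul]; push_cast; ring_nf
    have e3 : exp ((2 * A₁ + 2 * r) * (T - t₀)) = exp ((A₁ + r) * (T - t₀)) ^ 2 := by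
      rw [← exp_nat_mul]; push_cast; ring_nf
    rw [e2] at hVw
    rw [e3] at hP
    rw [Real.norm_of_nonneg (le_max_right _ _), one_mul, Real.norm_eq_abs, e1]
    set D := (exp ((A₁ + r) * (T - t₀)) ^ 2
      - (exp (A₁ * (T - w.1)) * exp (r * (T - w.1))) ^ 2) * (w.2 - x₀) ^ 2
      - 2 * (exp (A₁ * (T - w.1)) * exp (r * (T - w.1))) * (w.2 - x₀)
        * (exp (A₁ * (T - w.1)) * (exp (r * (T - w.1)) * x₀ + g₁ w.1)) with hD
    refine max_le ?_ (abs_nonneg _)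
    have h1 : 0 * (w.1 - t₀) + 0 * (w.2 - x₀) + 1 / 2 * P * (w.2 - x₀) ^ 2 - V w.1 w.2
        ≤ (1 / 2) * D := by
      have h2 := mul_le_mul_of_nonneg_right hP (sq_nonneg (w.2 - x₀))
      have h3 := sq_nonneg (exp (A₁ * (T - w.1)) * (exp (r * (T - w.1)) * x₀ + g₁ w.1))
      rw [hD]
      linarith
    linarith [le_abs_self D, abs_nonneg D]
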